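/- If there do not exist two nonzero mutually orthogonal subspaces S₁, S₂ of ℂ^N that are both invariant under every Lindblad operator V_d (i.e., V_d(Sᵢ) ⊆ Sᵢ for all d and i = 1, 2), then the Lindblad generator has a unique steady state. -/

import Mathlib

open Matrix
open scoped ComplexOrder

/-- The Lindblad generator `𝓛(ρ) = -i[H,ρ] + Σ_d (V_d ρ V_d† - ½(V_d† V_d ρ + ρ V_d† V_d))`. -/
noncomputable def lindblad {n : Type*} [Fintype n] [DecidableEq n] {ι : Type*} [Fintype ι]
    (H : Matrix n n ℂ) (V : ι → Matrix n n ℂ) (ρ : Matrix n n ℂ) : Matrix n n ℂ :=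
  -Complex.I • (H * ρ - ρ * H) +
    ∑ d, (V d * ρ * (V d)ᴴ - (1 / 2 : ℂ) • ((V d)ᴴ * V d * ρ + ρ * ((V d)ᴴ * V d)))

/-- A density matrix: positive semidefinite with trace one. -/
def IsDensityMatrix {n : Type*} [Fintype n] (ρ : Matrix n n ℂ) : Prop :=
  ρ.PosSemidef ∧ ρ.trace = 1

/-- A steady state of the Lindblad dynamics. -/
noncomputable def IsSteadyState {n : Type*} [Fintype n] [DecidableEq n] {ι : Type*} [Fintype ι]
    (H : Matrix n n ℂ) (V : ι → Matrix n n ℂ) (ρ : Matrix n n ℂ) : Prop :=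
  IsDensityMatrix ρ ∧ lindblad H V ρ = 0

/-- The support of a matrix: its range as a linear map `ℂ^N → ℂ^N`. -/
noncomputable def matSupport {n : Type*} [Fintype n] (ρ : Matrix n n ℂ) :
    Submodule ℂ (n → ℂ) :=
  LinearMap.range ρ.mulVecLin

/-- An extremal steady state: it cannot be written as a nontrivial convex combination
of two steady states other than itself. -/
noncomputable def IsExtremalSteadyState {n : Type*} [Fintype n] [DecidableEq n]
    {ι : Type*} [Fintype ι]
    (H : Matrix n n ℂ) (V : ι → Matrix n n ℂ) (ρ : Matrix n n ℂ) : Prop :=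
  IsSteadyState H V ρ ∧
    ∀ (a : ℝ) (ρ₁ ρ₂ : Matrix n n ℂ), 0 < a → a < 1 →
      IsSteadyState H V ρ₁ → IsSteadyState H V ρ₂ →
      ρ = a • ρ₁ + (1 - a) • ρ₂ → ρ₁ = ρ ∧ ρ₂ = ρ

section MarkovChain

variable {n : Type*} [Fintype n]

/-- For a stationary signed measure `a` of a continuous-time Markov chain with rates `w`, no rate
leads from the set where `a` is positive to its complement. -/
lemma rate_eq_zero_of_stationary (w : n → n → ℝ) (hw : ∀ i j, 0 ≤ w i j) (a : n → ℝ)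
    (h : ∀ i, ∑ j, w i j * a j = a i * ∑ k, w k i) {j k : n} (hj : 0 < a j) (hk : a k ≤ 0) :
    w k j = 0 := by
  classical
  have hsum : ∑ i with 0 < a i, ∑ j, w i j * a j = ∑ i with 0 < a i, ∑ k, w k i * a i :=
    Finset.sum_congr rfl fun i _ => by rw [h i, Finset.mul_sum]; simp only [mul_comm]
  rw [Finset.sum_comm (s := Finset.univ.filter fun i => 0 < a i) (t := Finset.univ)
      (f := fun i k => w k i * a i)] at hsum
  have hin : ∀ i, ∑ j, w i j * a j =
      ∑ j with 0 < a j, w i j * a j + ∑ j with ¬ 0 < a j, w i j * a j := fun i =>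
    (Finset.sum_filter_add_sum_filter_not _ _ _).symm
  rw [← Finset.sum_filter_add_sum_filter_not Finset.univ (fun k => 0 < a k)
      (fun k => ∑ i with 0 < a i, w k i * a i), Finset.sum_congr rfl fun i _ => hin i,
    Finset.sum_add_distrib, add_right_inj] at hsum
  have hle : ∑ i with 0 < a i, ∑ j with ¬ 0 < a j, w i j * a j ≤ 0 :=
    Finset.sum_nonpos fun i _ => Finset.sum_nonpos fun j hj =>
      mul_nonpos_of_nonneg_of_nonpos (hw i j) (not_lt.1 (Finset.mem_filter.1 hj).2)
  have hnn : ∀ k, ∀ i ∈ Finset.univ.filter (fun i => 0 < a i), 0 ≤ w k i * a i := fun k i hi =>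
    mul_nonneg (hw k i) (Finset.mem_filter.1 hi).2.le
  rw [hsum] at hle
  have hzero := le_antisymm hle (Finset.sum_nonneg fun k _ => Finset.sum_nonneg (hnn k))
  rw [Finset.sum_eq_zero_iff_of_nonneg fun k _ => Finset.sum_nonneg (hnn k)] at hzero
  have hrow := hzero k (by simpa using hk)
  rw [Finset.sum_eq_zero_iff_of_nonneg (hnn k)] at hrow
  exact (mul_eq_zero.1 (hrow j (by simpa using hj))).resolve_right hj.ne'

end MarkovChain

section Lindblad

variable {n : Type*} [Fintype n] [DecidableEq n] {ι : Type*} [Fintype ι]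

/-- The Lindblad generator as a linear map. -/
noncomputable def lindbladLinearMap (H : Matrix n n ℂ) (V : ι → Matrix n n ℂ) :
    Matrix n n ℂ →ₗ[ℂ] Matrix n n ℂ where
  toFun := lindblad H V
  map_add' A B := by
    simp only [lindblad, mul_add, add_mul, smul_add, smul_sub, Finset.sum_add_distrib,
      Finset.sum_sub_distrib]
    abel
  map_smul' c A := by
    simp only [lindblad, Algebra.mul_smul_comm, Algebra.smul_mul_assoc, RingHom.id_apply,
      smul_add, Finset.smul_sum, smul_sub, smul_comm c]

lemma trace_lindblad (H : Matrix n n ℂ) (V : ι → Matrix n n ℂ) (ρ : Matrix n n ℂ) :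
    (lindblad H V ρ).trace = 0 := by
  have hd : ∀ d, (V d * ρ * (V d)ᴴ).trace = ((V d)ᴴ * V d * ρ).trace := fun d => by
    rw [Matrix.trace_mul_comm, Matrix.mul_assoc]
  have hd' : ∀ d, (ρ * ((V d)ᴴ * V d)).trace = ((V d)ᴴ * V d * ρ).trace := fun d =>
    Matrix.trace_mul_comm _ _
  simp only [lindblad, trace_add, trace_smul, trace_sub, trace_sum, hd, hd',
    Matrix.trace_mul_comm H ρ, sub_self, smul_eq_mul, mul_zero, zero_add]
  exact Finset.sum_eq_zero fun d _ => by ring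

lemma conjTranspose_lindblad {H : Matrix n n ℂ} (hH : H.IsHermitian) (V : ι → Matrix n n ℂ)
    (ρ : Matrix n n ℂ) : (lindblad H V ρ)ᴴ = lindblad H V ρᴴ := by
  simp only [lindblad, conjTranspose_add, conjTranspose_smul, conjTranspose_sub,
    conjTranspose_sum, conjTranspose_mul, conjTranspose_conjTranspose, hH.eq, Matrix.mul_assoc]
  congr 1
  · simp [smul_sub, neg_add_eq_sub]
  · refine Finset.sum_congr rfl fun d _ => ?_
    simp [add_comm]

/-- Unitary covariance of the Lindblad generator. -/
lemma lindblad_unitary_conj (H : Matrix n n ℂ) (V : ι → Matrix n n ℂ) (ρ : Matrix n n ℂ)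
    {U : Matrix n n ℂ} (hU : U * Uᴴ = 1) :
    lindblad (Uᴴ * H * U) (fun d => Uᴴ * V d * U) (Uᴴ * ρ * U) =
      Uᴴ * lindblad H V ρ * U := by
  have hc : ∀ A : Matrix n n ℂ, U * (Uᴴ * A) = A := fun A => by
    rw [← Matrix.mul_assoc, hU, Matrix.one_mul]
  simp only [lindblad, mul_add, add_mul, mul_sub, sub_mul, Finset.mul_sum, Finset.sum_mul,
    Algebra.mul_smul_comm, Algebra.smul_mul_assoc, conjTranspose_mul,
    conjTranspose_conjTranspose, Matrix.mul_assoc, hc]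

lemma lindblad_diagonal_apply_self (H : Matrix n n ℂ) (V : ι → Matrix n n ℂ) (a : n → ℝ)
    (i : n) :
    lindblad H V (diagonal fun j => (a j : ℂ)) i i =
      ((∑ j, (∑ d, Complex.normSq (V d i j)) * a j -
        a i * ∑ k, ∑ d, Complex.normSq (V d k i) : ℝ) : ℂ) := by
  have h1 : ∀ d, (V d * diagonal (fun j => (a j : ℂ)) * (V d)ᴴ) i i =
      ∑ j, (Complex.normSq (V d i j) : ℂ) * a j := fun d => by
    simp only [Matrix.mul_apply (M := V d * _), mul_diagonal, conjTranspose_apply,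
      Complex.normSq_eq_conj_mul_self]
    exact Finset.sum_congr rfl fun j _ => by rw [Complex.star_def]; ring
  have h2 : ∀ d, ((V d)ᴴ * V d) i i = ∑ k, (Complex.normSq (V d k i) : ℂ) := fun d => by
    simp only [Matrix.mul_apply, conjTranspose_apply, Complex.normSq_eq_conj_mul_self,
      Complex.star_def]
  simp only [lindblad, Matrix.add_apply, Matrix.smul_apply, Matrix.sub_apply, Matrix.sum_apply,
    mul_diagonal, diagonal_mul, h1, h2, smul_eq_mul]
  push_cast
  simp only [Finset.sum_sub_distrib, Finset.sum_mul, Finset.mul_sum]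
  rw [Finset.sum_comm, Finset.sum_comm (s := (Finset.univ : Finset n)) (t := Finset.univ)
    (f := fun k d => (a i : ℂ) * (Complex.normSq (V d k i) : ℂ))]
  rw [show -Complex.I * (H i i * a i - a i * H i i) = 0 by ring, zero_add]
  congr 1
  refine Finset.sum_congr rfl fun d _ => ?_
  simp only [← Finset.sum_mul, ← Finset.mul_sum]
  ring

/-- The vectors whose coordinates in the columns of `U` vanish on `s`. -/
def coordinateSubspace (U : Matrix n n ℂ) (s : Set n) : Submodule ℂ (n → ℂ) where
  carrier := {x | ∀ k ∈ s, (Uᴴ *ᵥ x) k = 0}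
  zero_mem' := by simp
  add_mem' hx hy k hk := by simp [mulVec_add, hx k hk, hy k hk]
  smul_mem' c x hx k hk := by simp [mulVec_smul, hx k hk]

lemma coordinateSubspace_ne_bot {U : Matrix n n ℂ} (hU : Uᴴ * U = 1) {s : Set n} {i : n}
    (hi : i ∉ s) : coordinateSubspace U s ≠ ⊥ := by
  intro h
  have hUi : Uᴴ *ᵥ (U *ᵥ Pi.single i 1) = Pi.single i 1 := by
    rw [mulVec_mulVec, hU, one_mulVec]
  have hmem : U *ᵥ Pi.single i 1 ∈ coordinateSubspace U s := fun k hk => by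
    rw [hUi, Pi.single_eq_of_ne]
    rintro rfl
    exact hi hk
  rw [h, Submodule.mem_bot] at hmem
  rw [hmem, mulVec_zero] at hUi
  simpa using congrFun hUi i

lemma mulVec_mem_coordinateSubspace {U : Matrix n n ℂ} (hU : U * Uᴴ = 1) {s : Set n}
    {A : Matrix n n ℂ} (hA : ∀ k ∈ s, ∀ j ∉ s, (Uᴴ * A * U) k j = 0) {x : n → ℂ}
    (hx : x ∈ coordinateSubspace U s) : A *ᵥ x ∈ coordinateSubspace U s := by
  intro k hk
  have h : Uᴴ *ᵥ (A *ᵥ x) = (Uᴴ * A * U) *ᵥ (Uᴴ *ᵥ x) := by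
    rw [mulVec_mulVec, mulVec_mulVec, Matrix.mul_assoc _ U, hU, Matrix.mul_one]
  rw [h]
  refine Finset.sum_eq_zero fun j _ => ?_
  by_cases hj : j ∈ s
  · exact mul_eq_zero_of_right _ (hx j hj)
  · exact mul_eq_zero_of_left (hA k hk j hj) _

lemma dotProduct_eq_zero_of_mem_coordinateSubspace {U : Matrix n n ℂ} (hU : U * Uᴴ = 1)
    {s t : Set n} (hst : s ∪ t = Set.univ) {x y : n → ℂ} (hx : x ∈ coordinateSubspace U s)
    (hy : y ∈ coordinateSubspace U t) : star x ⬝ᵥ y = 0 := by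
  have h : star x ⬝ᵥ y = star (Uᴴ *ᵥ x) ⬝ᵥ (Uᴴ *ᵥ y) := by
    rw [star_mulVec, conjTranspose_conjTranspose, dotProduct_mulVec, vecMul_vecMul, hU,
      vecMul_one]
  rw [h]
  refine Finset.sum_eq_zero fun k _ => ?_
  rcases (hst ▸ Set.mem_univ k : k ∈ s ∪ t) with hk | hk
  · simp [hx k hk]
  · simp [hy k hk]

/-- In an eigenbasis of a Hermitian matrix killed by the Lindblad generator, the Lindblad
operators do not lead from positive eigenvalues to nonpositive ones, nor from negative eigenvalues
to nonnegative ones. -/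
lemma lindblad_operator_apply_eq_zero {H : Matrix n n ℂ} {V : ι → Matrix n n ℂ}
    {a : n → ℝ} (h : lindblad H V (diagonal fun j => (a j : ℂ)) = 0) {j k : n}
    (hjk : 0 < a j ∧ a k ≤ 0 ∨ a j < 0 ∧ 0 ≤ a k) (d : ι) : V d k j = 0 := by
  have hstat : ∀ i, ∑ j, (∑ d, Complex.normSq (V d i j)) * a j =
      a i * ∑ k, ∑ d, Complex.normSq (V d k i) := fun i => by
    have hi := lindblad_diagonal_apply_self H V a i
    rw [h, Matrix.zero_apply, eq_comm, Complex.ofReal_eq_zero] at hi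
    exact sub_eq_zero.1 hi
  have hw : ∀ i j, 0 ≤ ∑ d, Complex.normSq (V d i j) := fun i j =>
    Finset.sum_nonneg fun d _ => Complex.normSq_nonneg _
  have hzero : ∑ d, Complex.normSq (V d k j) = 0 := by
    rcases hjk with ⟨hj, hk⟩ | ⟨hj, hk⟩
    · exact rate_eq_zero_of_stationary _ hw a hstat hj hk
    · refine rate_eq_zero_of_stationary _ hw (fun i => -a i) (fun i => ?_)
        (neg_pos.2 hj) (neg_nonpos.2 hk)
      simp only [mul_neg, Finset.sum_neg_distrib, neg_mul, hstat i]
  rw [Finset.sum_eq_zero_iff_of_nonneg fun d _ => Complex.normSq_nonneg _] at hzero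
  exact Complex.normSq_eq_zero.1 (hzero d (Finset.mem_univ d))

/-- Without two nonzero orthogonal subspaces invariant under the Lindblad operators, every
Hermitian matrix killed by the Lindblad generator is semidefinite. -/
lemma posSemidef_or_neg_posSemidef_of_lindblad_eq_zero {H : Matrix n n ℂ}
    {V : ι → Matrix n n ℂ}
    (hno : ¬ ∃ S₁ S₂ : Submodule ℂ (n → ℂ), S₁ ≠ ⊥ ∧ S₂ ≠ ⊥ ∧
      (∀ x ∈ S₁, ∀ y ∈ S₂, star x ⬝ᵥ y = 0) ∧
      (∀ d : ι, ∀ x ∈ S₁, (V d).mulVec x ∈ S₁) ∧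
      (∀ d : ι, ∀ x ∈ S₂, (V d).mulVec x ∈ S₂))
    {X : Matrix n n ℂ} (hX : X.IsHermitian) (h : lindblad H V X = 0) :
    X.PosSemidef ∨ (-X).PosSemidef := by
  set a := hX.eigenvalues
  obtain ⟨U, hU, hU', hXU⟩ : ∃ U : Matrix n n ℂ, Uᴴ * U = 1 ∧ U * Uᴴ = 1 ∧
      X = U * diagonal (fun i => (a i : ℂ)) * Uᴴ :=
    ⟨hX.eigenvectorUnitary, Unitary.coe_star_mul_self _, Unitary.coe_mul_star_self _,
      hX.spectral_theorem⟩
  have hdiag : Uᴴ * X * U = diagonal (fun i => (a i : ℂ)) := by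
    rw [hXU, ← Matrix.mul_assoc, ← Matrix.mul_assoc, hU, Matrix.one_mul, Matrix.mul_assoc, hU,
      Matrix.mul_one]
  have hL := lindblad_unitary_conj H V X hU'
  rw [hdiag, h, Matrix.mul_zero, Matrix.zero_mul] at hL
  by_contra! hcon
  refine hno ⟨coordinateSubspace U {k | a k ≤ 0}, coordinateSubspace U {k | 0 ≤ a k}, ?_, ?_,
    fun x hx y hy => dotProduct_eq_zero_of_mem_coordinateSubspace hU' ?_ hx hy,
    fun d x hx => mulVec_mem_coordinateSubspace hU' (fun k hk j hj => ?_) hx,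
    fun d x hx => mulVec_mem_coordinateSubspace hU' (fun k hk j hj => ?_) hx⟩
  · rw [hXU] at hcon
    obtain ⟨i, hi⟩ : ∃ i, 0 < a i := by
      by_contra! hle
      refine hcon.2 ?_
      rw [← Matrix.neg_mul, ← Matrix.mul_neg, diagonal_neg]
      refine (PosSemidef.diagonal fun i => ?_).mul_mul_conjTranspose_same U
      have hi : (a i : ℂ) ≤ 0 := by exact_mod_cast hle i
      exact neg_nonneg.2 hi
    exact coordinateSubspace_ne_bot hU (i := i) (by simpa using hi)
  · rw [hXU] at hcon
    obtain ⟨i, hi⟩ : ∃ i, a i < 0 := by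
      by_contra! hle
      refine hcon.1 ((PosSemidef.diagonal fun i => ?_).mul_mul_conjTranspose_same U)
      simpa using hle i
    exact coordinateSubspace_ne_bot hU (i := i) (by simpa using hi)
  · ext k
    simpa using le_total (a k) 0
  · exact lindblad_operator_apply_eq_zero hL (.inl ⟨not_le.1 hj, hk⟩) d
  · exact lindblad_operator_apply_eq_zero hL (.inr ⟨not_le.1 hj, hk⟩) d

/-- The Lindblad generator kills some nonzero Hermitian matrix. -/
lemma exists_isHermitian_lindblad_eq_zero [Nonempty n] {H : Matrix n n ℂ} (hH : H.IsHermitian)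
    (V : ι → Matrix n n ℂ) : ∃ X : Matrix n n ℂ, X.IsHermitian ∧ X ≠ 0 ∧ lindblad H V X = 0 := by
  obtain ⟨Y, hY, hY0⟩ : ∃ Y, lindbladLinearMap H V Y = 0 ∧ Y ≠ 0 := by
    by_contra! hinj
    have hsurj := LinearMap.injective_iff_surjective.1
      ((injective_iff_map_eq_zero (lindbladLinearMap H V)).2 hinj)
    obtain ⟨ρ, hρ⟩ := hsurj 1
    have htr := trace_lindblad H V ρ
    rw [show lindblad H V ρ = 1 from hρ, trace_one] at htr
    exact Fintype.card_ne_zero (Nat.cast_eq_zero.1 htr)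
  have hYs : lindbladLinearMap H V Yᴴ = 0 := by
    change lindblad H V Yᴴ = 0
    rw [← conjTranspose_lindblad hH, show lindblad H V Y = 0 from hY, conjTranspose_zero]
  by_cases hre : Y + Yᴴ = 0
  · refine ⟨Complex.I • Y, ?_, smul_ne_zero Complex.I_ne_zero hY0, ?_⟩
    · rw [Matrix.IsHermitian, conjTranspose_smul, ← neg_eq_of_add_eq_zero_right hre]
      simp
    · exact ((lindbladLinearMap H V).map_smul _ _).trans (by rw [hY, smul_zero])
  · refine ⟨Y + Yᴴ, isHermitian_add_transpose_self Y, hre, ?_⟩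
    exact ((lindbladLinearMap H V).map_add _ _).trans (by rw [hY, hYs, add_zero])

lemma IsSteadyState.of_posSemidef {H : Matrix n n ℂ} {V : ι → Matrix n n ℂ} {X : Matrix n n ℂ}
    (hX : X.PosSemidef) (hX0 : X ≠ 0) (h : lindblad H V X = 0) :
    IsSteadyState H V (X.trace⁻¹ • X) := by
  have htr : X.trace ≠ 0 := fun h0 => hX0 (hX.trace_eq_zero_iff.1 h0)
  refine ⟨⟨hX.smul (inv_nonneg.2 hX.trace_nonneg), ?_⟩, ?_⟩
  · rw [trace_smul, smul_eq_mul, inv_mul_cancel₀ htr]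
  · exact ((lindbladLinearMap H V).map_smul _ _).trans
      (by rw [show lindbladLinearMap H V X = 0 from h, smul_zero])

end Lindblad

/-- If there do not exist two nonzero mutually orthogonal subspaces both invariant under
every Lindblad operator, then the steady state is unique. -/
theorem unique_steady_state_of_no_two_orthogonal_invariant_subspaces
    (N : ℕ) (hN : 1 ≤ N)
    (H : Matrix (Fin N) (Fin N) ℂ) (hH : H.IsHermitian)
    {ι : Type*} [Fintype ι] (V : ι → Matrix (Fin N) (Fin N) ℂ)
    (hno : ¬ ∃ S₁ S₂ : Submodule ℂ (Fin N → ℂ), S₁ ≠ ⊥ ∧ S₂ ≠ ⊥ ∧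
      (∀ x ∈ S₁, ∀ y ∈ S₂, star x ⬝ᵥ y = 0) ∧
      (∀ d : ι, ∀ x ∈ S₁, (V d).mulVec x ∈ S₁) ∧
      (∀ d : ι, ∀ x ∈ S₂, (V d).mulVec x ∈ S₂)) :
    ∃! ρ : Matrix (Fin N) (Fin N) ℂ, IsSteadyState H V ρ := by
  have : Nonempty (Fin N) := ⟨⟨0, hN⟩⟩
  have hsemi := fun {X : Matrix (Fin N) (Fin N) ℂ} =>
    posSemidef_or_neg_posSemidef_of_lindblad_eq_zero (H := H) hno (X := X)
  obtain ⟨X, hX, hX0, hLX⟩ := exists_isHermitian_lindblad_eq_zero hH V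
  have hex : ∃ ρ, IsSteadyState H V ρ := by
    rcases hsemi hX hLX with hpos | hneg
    · exact ⟨_, .of_posSemidef hpos hX0 hLX⟩
    · exact ⟨_, .of_posSemidef hneg (neg_ne_zero.2 hX0)
        (((lindbladLinearMap H V).map_neg X).trans (neg_eq_zero.2 hLX))⟩
  refine existsUnique_of_exists_of_unique hex fun ρ σ hρ hσ => sub_eq_zero.1 ?_
  have hL : lindblad H V (ρ - σ) = 0 :=
    ((lindbladLinearMap H V).map_sub ρ σ).trans (sub_eq_zero.2 (hρ.2.trans hσ.2.symm))
  have htr : (ρ - σ).trace = 0 := by rw [trace_sub, hρ.1.2, hσ.1.2, sub_self]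
  rcases hsemi (hρ.1.1.isHermitian.sub hσ.1.1.isHermitian) hL with hpos | hneg
  · exact hpos.trace_eq_zero_iff.1 htr
  · exact neg_eq_zero.1 (hneg.trace_eq_zero_iff.1 (by rw [trace_neg, htr, neg_zero]))
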